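/- Let N ≥ 1 and let φ be a red/blue coloring of the 3-element subsets of {0, 1, ..., N−1} such that among every 4 vertices there are at most 2 red triples. Define a red/blue coloring χ of the 4-element subsets of {0, 1, ..., 2^N − 1} by: for a_1 < a_2 < a_3 < a_4, set χ(a_1,a_2,a_3,a_4) = φ(δ_1, δ_2, δ_3) if δ_1, δ_2, δ_3 form a strictly monotone sequence, and χ(a_1,a_2,a_3,a_4) = blue otherwise. Then among every 5 vertices of {0, 1, ..., 2^N − 1} there are at most 3 red 4-subsets under χ. -/

import Mathlib

/-- For distinct nonnegative integers `a` and `b`, `bdelta a b` is the largest index `i`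
such that the `i`-th binary digits of `a` and `b` differ. -/
noncomputable def bdelta (a b : ℕ) : ℕ := sSup {i | a.testBit i ≠ b.testBit i}

theorem bdelta_isGreatest {a b : ℕ} (h : a ≠ b) :
    IsGreatest {i | a.testBit i ≠ b.testBit i} (bdelta a b) := by
  have hne : {i | a.testBit i ≠ b.testBit i}.Nonempty := by
    by_contra hc
    rw [Set.not_nonempty_iff_eq_empty, Set.eq_empty_iff_forall_notMem] at hc
    exact h (Nat.eq_of_testBit_eq fun i => by simpa using hc i)
  have hbdd : BddAbove {i | a.testBit i ≠ b.testBit i} := by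
    refine ⟨a + b, fun i hi => ?_⟩
    by_contra! hlt
    have hpow : i < 2 ^ i := Nat.lt_two_pow_self
    exact hi (by rw [Nat.testBit_lt_two_pow (by omega), Nat.testBit_lt_two_pow (by omega)])
  exact ⟨Nat.sSup_mem hne hbdd, fun i hi => le_csSup hbdd hi⟩

theorem testBit_eq_of_bdelta_lt {a b i : ℕ} (hi : bdelta a b < i) :
    a.testBit i = b.testBit i := by
  by_cases hab : a = b
  · rw [hab]
  · by_contra hne
    exact absurd ((bdelta_isGreatest hab).2 hne) (not_le.2 hi)

theorem testBit_bdelta_of_lt {a b : ℕ} (h : a < b) :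
    a.testBit (bdelta a b) = false ∧ b.testBit (bdelta a b) = true := by
  have hne : a.testBit (bdelta a b) ≠ b.testBit (bdelta a b) := (bdelta_isGreatest h.ne).1
  by_contra hc
  have hb : b.testBit (bdelta a b) = false ∧ a.testBit (bdelta a b) = true := by
    revert hne hc
    cases a.testBit (bdelta a b) <;> cases b.testBit (bdelta a b) <;> simp
  exact absurd (Nat.lt_of_testBit _ hb.1 hb.2 fun j hj => (testBit_eq_of_bdelta_lt hj).symm)
    h.le.not_gt

theorem bdelta_lt_of_lt_two_pow {a b N : ℕ} (h : a < b) (hb : b < 2 ^ N) : bdelta a b < N := by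
  by_contra! hN
  have := (testBit_bdelta_of_lt h).2
  rw [Nat.testBit_lt_two_pow (hb.trans_le (Nat.pow_le_pow_right (by norm_num) hN))] at this
  exact Bool.noConfusion this

theorem bdelta_ne_bdelta {a b c : ℕ} (hab : a < b) (hbc : b < c) : bdelta a b ≠ bdelta b c := by
  intro h
  have h1 := (testBit_bdelta_of_lt hab).2
  rw [h, (testBit_bdelta_of_lt hbc).1] at h1
  exact Bool.noConfusion h1

theorem bdelta_eq_max {a b c : ℕ} (hab : a < b) (hbc : b < c) :
    bdelta a c = max (bdelta a b) (bdelta b c) := by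
  refine (bdelta_isGreatest (hab.trans hbc).ne).unique ⟨?_, fun i hi => ?_⟩
  · rcases (bdelta_ne_bdelta hab hbc).lt_or_gt with h | h
    · rw [max_eq_right h.le, Set.mem_ofPred_eq, testBit_eq_of_bdelta_lt h]
      exact (bdelta_isGreatest hbc.ne).1
    · rw [max_eq_left h.le, Set.mem_ofPred_eq, ← testBit_eq_of_bdelta_lt h]
      exact (bdelta_isGreatest hab.ne).1
  · by_contra! hlt
    exact hi ((testBit_eq_of_bdelta_lt (max_lt_iff.1 hlt).1).trans
      (testBit_eq_of_bdelta_lt (max_lt_iff.1 hlt).2))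

theorem card_filter_powersetCard_eq_sum_erase {α : Type*} [DecidableEq α] {T : Finset α} {n : ℕ}
    (hT : T.card = n + 1) (f : Finset α → Bool) :
    ((T.powersetCard n).filter (fun e => f e = true)).card = ∑ x ∈ T, (f (T.erase x)).toNat := by
  have himage : T.powersetCard n = T.image T.erase := by
    ext e
    simp only [Finset.mem_powersetCard, Finset.mem_image]
    constructor
    · rintro ⟨he, hcard⟩
      obtain ⟨x, hx⟩ := Finset.card_eq_one.1
        (show (T \ e).card = 1 by rw [Finset.card_sdiff_of_subset he]; omega)
      have hxT : x ∈ T := (Finset.mem_sdiff.1 (hx ▸ Finset.mem_singleton_self x)).1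
      refine ⟨x, hxT, ?_⟩
      rw [← Finset.sdiff_singleton_eq_erase, ← hx, Finset.sdiff_sdiff_eq_self he]
    · rintro ⟨x, hx, rfl⟩
      exact ⟨Finset.erase_subset _ _, by rw [Finset.card_erase_of_mem hx, hT]; rfl⟩
  rw [Finset.card_filter, himage, Finset.sum_image (Finset.erase_injOn T)]
  exact Finset.sum_congr rfl fun x _ => by cases f (T.erase x) <;> rfl

theorem card_filter_powersetCard_three {α : Type*} [LinearOrder α] {a b c d : α}
    (hab : a < b) (hbc : b < c) (hcd : c < d) (f : Finset α → Bool) :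
    ((({a, b, c, d} : Finset α).powersetCard 3).filter (fun e => f e = true)).card =
      (f {b, c, d}).toNat + (f {a, c, d}).toNat + (f {a, b, d}).toNat + (f {a, b, c}).toNat := by
  have e1 : ({a, b, c, d} : Finset α).erase a = {b, c, d} := by grind
  have e2 : ({a, b, c, d} : Finset α).erase b = {a, c, d} := by grind
  have e3 : ({a, b, c, d} : Finset α).erase c = {a, b, d} := by grind
  have e4 : ({a, b, c, d} : Finset α).erase d = {a, b, c} := by grind
  rw [card_filter_powersetCard_eq_sum_erase (by grind), Finset.sum_insert (by grind),
    Finset.sum_insert (by grind), Finset.sum_pair hcd.ne, e1, e2, e3, e4]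
  ring

theorem card_filter_powersetCard_four {α : Type*} [LinearOrder α] {a b c d e : α}
    (hab : a < b) (hbc : b < c) (hcd : c < d) (hde : d < e) (f : Finset α → Bool) :
    ((({a, b, c, d, e} : Finset α).powersetCard 4).filter (fun e => f e = true)).card =
      (f {b, c, d, e}).toNat + (f {a, c, d, e}).toNat + (f {a, b, d, e}).toNat +
        (f {a, b, c, e}).toNat + (f {a, b, c, d}).toNat := by
  have e1 : ({a, b, c, d, e} : Finset α).erase a = {b, c, d, e} := by grind
  have e2 : ({a, b, c, d, e} : Finset α).erase b = {a, c, d, e} := by grind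
  have e3 : ({a, b, c, d, e} : Finset α).erase c = {a, b, d, e} := by grind
  have e4 : ({a, b, c, d, e} : Finset α).erase d = {a, b, c, e} := by grind
  have e5 : ({a, b, c, d, e} : Finset α).erase e = {a, b, c, d} := by grind
  rw [card_filter_powersetCard_eq_sum_erase (by grind), Finset.sum_insert (by grind),
    Finset.sum_insert (by grind), Finset.sum_insert (by grind), Finset.sum_pair hde.ne,
    e1, e2, e3, e4, e5]
  ring

theorem exists_lt_of_card_eq_five {α : Type*} [LinearOrder α] {S : Finset α} (hS : S.card = 5) :
    ∃ a b c d e, a < b ∧ b < c ∧ c < d ∧ d < e ∧ S = {a, b, c, d, e} := by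
  let g := S.orderEmbOfFin hS
  refine ⟨g 0, g 1, g 2, g 3, g 4, by simp, by simp, by simp, by simp, ?_⟩
  ext x
  rw [← Finset.mem_coe, ← Finset.range_orderEmbOfFin S hS, Set.mem_range]
  simp [Fin.exists_fin_succ, g, eq_comm]

/-- Let `N ≥ 1` and let `φ` be a red/blue coloring (`red = true`) of the 3-element subsets of
`{0,…,N-1}` such that among every 4 vertices there are at most 2 red triples. Define a coloring
`χ` of the 4-element subsets of `{0,…,2^N - 1}` by: for `a₁ < a₂ < a₃ < a₄`,
`χ {a₁,a₂,a₃,a₄} = φ {δ₁,δ₂,δ₃}` if `δ₁, δ₂, δ₃` form a strictly monotone sequence, and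
`χ {a₁,a₂,a₃,a₄} = blue` (`false`) otherwise. Then among every 5 vertices of `{0,…,2^N - 1}`
there are at most 3 red 4-subsets under `χ`. -/
theorem stmt12 (N : ℕ) (hN : 1 ≤ N) (φ : Finset ℕ → Bool)
    (hφ : ∀ S ⊆ Finset.range N, S.card = 4 →
      ((S.powersetCard 3).filter (fun e => φ e = true)).card ≤ 2)
    (χ : Finset ℕ → Bool)
    (hχ : ∀ a1 a2 a3 a4 : ℕ, a1 < a2 → a2 < a3 → a3 < a4 → a4 < 2 ^ N →
      χ {a1, a2, a3, a4} =
        if (bdelta a1 a2 < bdelta a2 a3 ∧ bdelta a2 a3 < bdelta a3 a4) ∨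
            (bdelta a3 a4 < bdelta a2 a3 ∧ bdelta a2 a3 < bdelta a1 a2)
          then φ {bdelta a1 a2, bdelta a2 a3, bdelta a3 a4}
          else false) :
    ∀ S ⊆ Finset.range (2 ^ N), S.card = 5 →
      ((S.powersetCard 4).filter (fun e => χ e = true)).card ≤ 3 := by
  intro S hS hcard
  obtain ⟨a, b, c, d, e, hab, hbc, hcd, hde, rfl⟩ := exists_lt_of_card_eq_five hcard
  have he : e < 2 ^ N := Finset.mem_range.1 (hS (by simp))
  rw [card_filter_powersetCard_four hab hbc hcd hde,
    hχ b c d e hbc hcd hde he, hχ a c d e (hab.trans hbc) hcd hde he,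
    hχ a b d e hab (hbc.trans hcd) hde he, hχ a b c e hab hbc (hcd.trans hde) he,
    hχ a b c d hab hbc hcd (hde.trans he),
    bdelta_eq_max hab hbc, bdelta_eq_max hbc hcd, bdelta_eq_max hcd hde]
  have h12 := bdelta_ne_bdelta hab hbc
  have h23 := bdelta_ne_bdelta hbc hcd
  have h34 := bdelta_ne_bdelta hcd hde
  have w1 := bdelta_lt_of_lt_two_pow hab (by omega : b < 2 ^ N)
  have w2 := bdelta_lt_of_lt_two_pow hbc (by omega : c < 2 ^ N)
  have w3 := bdelta_lt_of_lt_two_pow hcd (by omega : d < 2 ^ N)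
  have w4 := bdelta_lt_of_lt_two_pow hde he
  generalize bdelta a b = p at *
  generalize bdelta b c = q at *
  generalize bdelta c d = r at *
  generalize bdelta d e = s at *
  have bound : ∀ w x y z : ℕ, w < x → x < y → y < z → z < N →
      (φ {x, y, z}).toNat + (φ {w, y, z}).toNat + (φ {w, x, z}).toNat + (φ {w, x, y}).toNat ≤ 2 :=
    fun w x y z hwx hxy hyz hz => by
      rw [← card_filter_powersetCard_three hwx hxy hyz]
      exact hφ _ (by intro i; simp only [Finset.mem_insert, Finset.mem_singleton,
        Finset.mem_range]; omega) <| by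
        rw [Finset.card_insert_of_notMem (by simp; omega),
          Finset.card_insert_of_notMem (by simp; omega), Finset.card_pair hyz.ne]
  have rev : ∀ x y z : ℕ, ({x, y, z} : Finset ℕ) = {z, y, x} := fun x y z => by
    ext i; simp only [Finset.mem_insert, Finset.mem_singleton]; tauto
  have toNat_ite_le : ∀ (P : Prop) [Decidable P] (t : Bool),
      (if P then t else false).toNat ≤ if P then 1 else 0 := fun P _ t => by
    split_ifs
    · exact Bool.toNat_le t
    · exact le_rfl
  rcases h12.lt_or_gt with h1 | h1 <;> rcases h23.lt_or_gt with h2 | h2 <;>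
    rcases h34.lt_or_gt with h3 | h3
  all_goals simp only [max_eq_left, max_eq_right, h1.le, h2.le, h3.le]
  · have := bound p q r s h1 h2 h3 w4
    have := Bool.toNat_le (φ {q, r, s})
    rw [if_pos (by omega), if_pos (by omega), if_pos (by omega), if_pos (by omega)]
    omega
  iterate 6
    · refine (add_le_add (add_le_add (add_le_add (add_le_add (toNat_ite_le _ _)
        (toNat_ite_le _ _)) (toNat_ite_le _ _)) (toNat_ite_le _ _)) (toNat_ite_le _ _)).trans ?_
      split_ifs <;> omega
  · have := bound s r q p h3 h2 h1 w1
    rw [rev r q p, rev s q p, rev s r p, rev s r q] at this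
    have := Bool.toNat_le (φ {p, q, r})
    rw [if_pos (by omega), if_pos (by omega), if_pos (by omega), if_pos (by omega)]
    omega
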